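/- (Classical analytic Egorov / convergent Lie series for the flow.) Let s > 0 and 0 < σ < s. Let a ∈ A_s and let G ∈ A_s be real-valued and nonzero (so G is C^∞ with all derivatives bounded, and its Hamiltonian flow φ_t^G is complete). Then for every t ∈ ℝ with |t| < σ²/(2‖G‖_s), the series Σ_{j=0}^∞ (t^j/j!) Ad_G^j(a) converges absolutely in the norm ‖·‖_{s−σ}, its sum equals the function z ↦ a(φ_t^G(z)), and in particular a∘φ_t^G ∈ A_{s−σ}. -/

import Mathlib

open MeasureTheory Real Filter Topology
open scoped ENNReal BigOperators

noncomputable section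

/-- Phase space ℝ^{2d} = (x, ξ). -/
abbrev Pd (d : ℕ) : Type := (Fin d → ℝ) × (Fin d → ℝ)

/-- Euclidean inner product on phase space. -/
def dotP {d : ℕ} (w z : Pd d) : ℝ :=
  (∑ j, w.1 j * z.1 j) + ∑ j, w.2 j * z.2 j

/-- Euclidean norm on phase space. -/
def normP {d : ℕ} (z : Pd d) : ℝ :=
  Real.sqrt ((∑ j, (z.1 j) ^ 2) + ∑ j, (z.2 j) ^ 2)

/-- Fourier transform  â(w) = ∫ e^{-i w·z} a(z) dz. -/
def fourierT {d : ℕ} (a : Pd d → ℂ) (w : Pd d) : ℂ :=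
  ∫ z : Pd d, Complex.exp (-(Complex.I * (dotP w z))) * a z

/-- The analytic norm ‖a‖_s = ∫ |â(w)| e^{s‖w‖} dw  (with values in ℝ≥0∞). -/
def Anorm {d : ℕ} (s : ℝ) (a : Pd d → ℂ) : ℝ≥0∞ :=
  ∫⁻ w : Pd d, ENNReal.ofReal (‖fourierT a w‖ * Real.exp (s * normP w))

/-- Membership in the space A_s : integrable with finite ‖·‖_s norm. -/
def MemAs {d : ℕ} (s : ℝ) (a : Pd d → ℂ) : Prop :=
  Integrable a ∧ Anorm s a < ⊤

instance fact2pi : Fact (0 < 2 * Real.pi) := ⟨Real.two_pi_pos⟩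

/-- The circle ℝ/2πℤ. -/
abbrev Circle2pi : Type := AddCircle (2 * Real.pi)

/-- The torus 𝕋^d = ℝ^d/2πℤ^d. -/
abbrev Torus (d : ℕ) : Type := Fin d → Circle2pi

/-- Cosine on the circle. -/
def aCos : Circle2pi → ℝ := Real.cos_periodic.lift

/-- Sine on the circle. -/
def aSin : Circle2pi → ℝ := Real.sin_periodic.lift

/-- The torus action Φ_τ^H on phase space: rotation by angle τ_j in the (x_j, ξ_j)-plane. -/
def PhiT {d : ℕ} (τ : Torus d) (z : Pd d) : Pd d :=
  (fun j => aCos (τ j) * z.1 j + aSin (τ j) * z.2 j,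
   fun j => -aSin (τ j) * z.1 j + aCos (τ j) * z.2 j)

/-- The one-parameter line t ↦ tω in the torus. -/
def lineTorus {d : ℕ} (ω : Fin d → ℝ) (t : ℝ) : Torus d :=
  fun j => ((t * ω j : ℝ) : Circle2pi)

/-- The harmonic oscillator flow φ_t^H = Φ_{tω}^H. -/
def phiH {d : ℕ} (ω : Fin d → ℝ) (t : ℝ) (z : Pd d) : Pd d :=
  PhiT (lineTorus ω t) z

/-- G_ω : the closure in 𝕋^d of the orbit {tω}. -/
def Gomega {d : ℕ} (ω : Fin d → ℝ) : Set (Torus d) :=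
  closure (Set.range (lineTorus ω))

/-- ν is the normalized Haar measure of the compact subgroup G_ω :
it is a probability measure, carried by G_ω, invariant under translation by
elements of G_ω.  These properties determine it uniquely. -/
def IsHaarOnG {d : ℕ} (ω : Fin d → ℝ) (ν : Measure (Torus d)) : Prop :=
  IsProbabilityMeasure ν ∧ ν (Gomega ω)ᶜ = 0 ∧
    ∀ g ∈ Gomega ω, Measure.map (fun τ => g + τ) ν = ν

/-- The average ⟨a⟩ of a along the harmonic oscillator flow. -/
def avg {d : ℕ} (ν : Measure (Torus d)) (a : Pd d → ℂ) (z : Pd d) : ℂ :=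
  ∫ τ, a (PhiT τ z) ∂ν

/-- The standard symplectic form ς((x,ξ),(y,η)) = ξ·y − x·η. -/
def symp {d : ℕ} (w v : Pd d) : ℝ :=
  (∑ j, w.2 j * v.1 j) - ∑ j, w.1 j * v.2 j

/-- The Moyal product a ♯_ℏ b. -/
def moyal {d : ℕ} (ℏ : ℝ) (a b : Pd d → ℂ) (z : Pd d) : ℂ :=
  (((2 * Real.pi) ^ (4 * d) : ℝ) : ℂ)⁻¹ *
    ∫ p : Pd d × Pd d,
      fourierT a p.1 * fourierT b (p.2 - p.1) *
        Complex.exp (Complex.I * ℏ / 2 * (symp p.1 (p.2 - p.1) : ℝ)) *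
        Complex.exp (Complex.I * (dotP p.2 z : ℝ))

/-- The Moyal commutator [a,b]_ℏ = a ♯_ℏ b − b ♯_ℏ a. -/
def moyalComm {d : ℕ} (ℏ : ℝ) (a b : Pd d → ℂ) : Pd d → ℂ :=
  fun z => moyal ℏ a b z - moyal ℏ b a z

/-- Coordinate vector in the x_j direction. -/
def ex {d : ℕ} (j : Fin d) : Pd d := (Pi.single j 1, 0)

/-- Coordinate vector in the ξ_j direction. -/
def exi {d : ℕ} (j : Fin d) : Pd d := (0, Pi.single j 1)

/-- Directional derivative of a complex-valued symbol. -/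
def pdC {d : ℕ} (v : Pd d) (f : Pd d → ℂ) (z : Pd d) : ℂ := fderiv ℝ f z v

/-- The Poisson bracket {a,b} = Σ_j (∂_{ξ_j}a ∂_{x_j}b − ∂_{x_j}a ∂_{ξ_j}b). -/
def poisson {d : ℕ} (a b : Pd d → ℂ) (z : Pd d) : ℂ :=
  ∑ j, (pdC (exi j) a z * pdC (ex j) b z - pdC (ex j) a z * pdC (exi j) b z)

/-- Iterated Moyal adjoint Ad_G^{♯ℏ,j}(a). -/
def adM {d : ℕ} (ℏ : ℝ) (G : Pd d → ℂ) : ℕ → (Pd d → ℂ) → (Pd d → ℂ)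
  | 0, a => a
  | j + 1, a => moyalComm ℏ G (adM ℏ G j a)

/-- The j-th term of the series defining Ψ_t^{G,ℏ} a. -/
def psiTerm {d : ℕ} (t ℏ : ℝ) (G a : Pd d → ℂ) (j : ℕ) : Pd d → ℂ :=
  fun z => ((Complex.I * t / ℏ) ^ j / (j.factorial : ℂ)) * adM ℏ G j a z

/-- Ψ_t^{G,ℏ} a = Σ_j (1/j!)(it/ℏ)^j Ad_G^{♯ℏ,j}(a). -/
def Psi {d : ℕ} (t ℏ : ℝ) (G a : Pd d → ℂ) (z : Pd d) : ℂ :=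
  ∑' j : ℕ, psiTerm t ℏ G a j z
/-- The Hamiltonian vector field X_G = (∂_ξ G, −∂_x G) of a real-valued symbol G. -/
def hamVF {d : ℕ} (G : Pd d → ℝ) (z : Pd d) : Pd d :=
  (fun j => fderiv ℝ G z (exi j), fun j => -(fderiv ℝ G z (ex j)))

/-- Poisson bracket {G, b} of a real-valued G with a complex-valued b. -/
def poissonR {d : ℕ} (G : Pd d → ℝ) (b : Pd d → ℂ) (z : Pd d) : ℂ :=
  ∑ j, ((fderiv ℝ G z (exi j) : ℂ) * pdC (ex j) b z -
        (fderiv ℝ G z (ex j) : ℂ) * pdC (exi j) b z)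

/-- Iterated Poisson adjoint Ad_G^j(a) = {G, Ad_G^{j−1}(a)}. -/
def adP {d : ℕ} (G : Pd d → ℝ) : ℕ → (Pd d → ℂ) → (Pd d → ℂ)
  | 0, a => a
  | j + 1, a => poissonR G (adP G j a)

section EuclideanFourier

open scoped FourierTransform

variable {E : Type*} [NormedAddCommGroup E] [InnerProductSpace ℝ E] [FiniteDimensional ℝ E]
  [MeasurableSpace E] [BorelSpace E]

/-- Locally integrable functions with the same pairings against Schwartz functions coincide. -/
theorem ae_eq_of_integral_schwartz_mul_eq {f g : E → ℂ} (hf : LocallyIntegrable f)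
    (hg : LocallyIntegrable g)
    (h : ∀ ψ : SchwartzMap E ℂ, ∫ x, ψ x * f x = ∫ x, ψ x * g x) : f =ᵐ[volume] g := by
  refine ae_eq_of_integral_contDiff_smul_eq hf hg fun u hu hcu => ?_
  have hu' : ContDiff ℝ ((⊤ : ℕ∞) : WithTop ℕ∞) (fun x => (u x : ℂ)) :=
    Complex.ofRealCLM.contDiff.comp hu
  have hcu' : HasCompactSupport (fun x => (u x : ℂ)) := hcu.comp_left (g := Complex.ofReal) rfl
  simpa using h (hcu'.toSchwartzMap hu')

theorem integral_schwartz_mul_fourierInv {h : E → ℂ} (hh : Integrable h)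
    (ψ : SchwartzMap E ℂ) : ∫ x, ψ x * 𝓕⁻ h x = ∫ x, (𝓕⁻ ψ) x * h x := by
  have key := VectorFourier.integral_fourierIntegral_smul_eq_flip (μ := volume) (ν := volume)
    (L := -(innerₗ E)) (f := ⇑ψ) (g := h) Real.continuous_fourierChar
    (by simpa using (continuous_inner (𝕜 := ℝ) (E := E)).fun_neg) ψ.integrable hh
  have e1 : ∀ k : E → ℂ, VectorFourier.fourierIntegral Real.fourierChar volume
      (-(innerₗ E)) k = 𝓕⁻ k := by
    intro k; ext w; simp [VectorFourier.fourierIntegral, Real.fourierInv_eq]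
  have e2 : (-(innerₗ E)).flip = -(innerₗ E) := by
    ext v w; simp [real_inner_comm]
  rw [e2, e1, e1] at key
  rw [SchwartzMap.fourierInv_coe]
  simpa using key.symm

theorem integral_schwartz_mul_fourier {h : E → ℂ} (hh : Integrable h)
    (ψ : SchwartzMap E ℂ) : ∫ x, ψ x * 𝓕 h x = ∫ x, (𝓕 ψ) x * h x := by
  have key := VectorFourier.integral_fourierIntegral_smul_eq_flip (μ := volume) (ν := volume)
    (L := innerₗ E) (f := ⇑ψ) (g := h) Real.continuous_fourierChar
    (by simpa using continuous_inner) ψ.integrable hh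
  have e2 : (innerₗ E).flip = innerₗ E := by
    ext v w; simp
  rw [e2] at key
  rw [SchwartzMap.fourier_coe]
  exact key.symm

/-- Fourier inversion, for an integrable function whose inverse Fourier transform is
integrable. -/
theorem fourier_fourierInv_ae_eq {h : E → ℂ} (hh : Integrable h) (hf : Integrable (𝓕⁻ h)) :
    𝓕 (𝓕⁻ h) =ᵐ[volume] h := by
  have hc : Continuous (𝓕 (𝓕⁻ h)) :=
    VectorFourier.fourierIntegral_continuous Real.continuous_fourierChar
      (by simpa using continuous_inner) hf
  refine ae_eq_of_integral_schwartz_mul_eq hc.locallyIntegrable hh.locallyIntegrable fun ψ => ?_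
  rw [integral_schwartz_mul_fourier hf, integral_schwartz_mul_fourierInv hh]
  simp

/-- The inverse Fourier transform of a function in `L¹ ∩ L²` is in `L²`. -/
theorem memLp_two_fourierInv {h : E → ℂ} (hh : Integrable h) (h2 : MemLp h 2) :
    MemLp (𝓕⁻ h) 2 := by
  have hc : Continuous (𝓕⁻ h) := by
    have : 𝓕⁻ h = fun w => 𝓕 h (-w) := by ext w; exact Real.fourierInv_eq_fourier_neg h w
    rw [this]
    exact (VectorFourier.fourierIntegral_continuous Real.continuous_fourierChar
      (by simpa using continuous_inner) hh).comp continuous_neg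
  set P : Lp ℂ 2 (volume : Measure E) := 𝓕⁻ (h2.toLp h) with hP
  have hPm : MemLp P 2 := Lp.memLp P
  refine hPm.ae_eq ?_
  refine ae_eq_of_integral_schwartz_mul_eq (hPm.locallyIntegrable (by norm_num))
    hc.locallyIntegrable fun ψ => ?_
  have := congrArg (fun T => T ψ)
    (MeasureTheory.Lp.fourierInv_toTemperedDistribution_eq (E := E) (h2.toLp h))
  simp only [TemperedDistribution.fourierInv_apply, Lp.toTemperedDistribution_apply] at this
  rw [integral_schwartz_mul_fourierInv hh, ← hP] at *
  simp only [smul_eq_mul] at this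
  rw [← this]
  refine integral_congr_ae ?_
  filter_upwards [h2.coeFn_toLp] with x hx
  rw [hx]

end EuclideanFourier

section PhaseSpaceFourier

open scoped FourierTransform

variable {d : ℕ}

/-- Inverse Fourier transform on phase space, normalised to be inverse to `fourierT`. -/
def invFT (h : Pd d → ℂ) (z : Pd d) : ℂ :=
  (((2 * Real.pi) ^ (2 * d) : ℝ) : ℂ)⁻¹ * ∫ w : Pd d, Complex.exp (Complex.I * dotP w z) * h w

/-- Phase space as a Euclidean space. -/
def euclEquiv (d : ℕ) : EuclideanSpace ℝ (Fin d ⊕ Fin d) ≃ᵐ Pd d :=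
  (MeasurableEquiv.toLp 2 (Fin d ⊕ Fin d → ℝ)).symm.trans
    (MeasurableEquiv.sumPiEquivProdPi fun _ => ℝ)

theorem euclEquiv_apply (x : EuclideanSpace ℝ (Fin d ⊕ Fin d)) :
    euclEquiv d x = (fun j => x (Sum.inl j), fun j => x (Sum.inr j)) := rfl

theorem measurePreserving_euclEquiv : MeasurePreserving (euclEquiv d) :=
  (PiLp.volume_preserving_ofLp (Fin d ⊕ Fin d)).trans
    (volume_measurePreserving_sumPiEquivProdPi fun _ => ℝ)

theorem continuous_euclEquiv : Continuous (euclEquiv d) := by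
  change Continuous fun x : EuclideanSpace ℝ (Fin d ⊕ Fin d) =>
    ((fun j => x (Sum.inl j), fun j => x (Sum.inr j)) : Pd d)
  fun_prop

theorem dotP_euclEquiv (x y : EuclideanSpace ℝ (Fin d ⊕ Fin d)) :
    dotP (euclEquiv d x) (euclEquiv d y) = inner ℝ x y := by
  simp [dotP, euclEquiv_apply, PiLp.inner_apply, mul_comm]

theorem fourierT_euclEquiv (a : Pd d → ℂ) (v : EuclideanSpace ℝ (Fin d ⊕ Fin d)) :
    fourierT a (euclEquiv d ((2 * π) • v)) = 𝓕 (a ∘ euclEquiv d) v := by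
  rw [fourierT, ← measurePreserving_euclEquiv.integral_comp (euclEquiv d).measurableEmbedding,
    Real.fourier_eq']
  congr 1; ext x
  rw [dotP_euclEquiv, real_inner_smul_left, real_inner_comm]
  simp only [Function.comp, smul_eq_mul]
  push_cast; ring_nf

theorem invFT_euclEquiv (h : Pd d → ℂ) (z : EuclideanSpace ℝ (Fin d ⊕ Fin d)) :
    invFT h (euclEquiv d z) = 𝓕⁻ (fun v => h (euclEquiv d ((2 * π) • v))) z := by
  rw [invFT, ← measurePreserving_euclEquiv.integral_comp (euclEquiv d).measurableEmbedding,
    Real.fourierInv_eq']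
  have := Measure.integral_comp_smul (volume : Measure (EuclideanSpace ℝ (Fin d ⊕ Fin d)))
    (fun x => Complex.exp (Complex.I * dotP (euclEquiv d x) (euclEquiv d z)) *
      h (euclEquiv d x)) (2 * π)
  rw [finrank_euclideanSpace, Fintype.card_sum, Fintype.card_fin, ← two_mul,
    abs_of_nonneg (by positivity), Complex.real_smul] at this
  rw [← Complex.ofReal_inv, ← this]
  congr 1; ext x
  rw [dotP_euclEquiv, real_inner_smul_left]
  simp only [smul_eq_mul]
  push_cast; ring_nf

theorem continuous_dotP_left (z : Pd d) : Continuous fun w : Pd d => dotP w z := by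
  unfold dotP; fun_prop

theorem integrable_comp_scaled {h : Pd d → ℂ} (hh : Integrable h) :
    Integrable fun v => h (euclEquiv d ((2 * π) • v)) :=
  (integrable_comp_smul_iff (volume : Measure (EuclideanSpace ℝ (Fin d ⊕ Fin d)))
    (fun v => h (euclEquiv d v)) (by positivity)).2
    ((measurePreserving_euclEquiv.integrable_comp_emb (euclEquiv d).measurableEmbedding).2 hh)

theorem ae_of_ae_scaled {p : Pd d → Prop} (h : ∀ᵐ v, p (euclEquiv d ((2 * π) • v))) :
    ∀ᵐ w, p w := by
  rw [ae_iff] at h ⊢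
  have h1 := Measure.addHaar_preimage_smul
    (volume : Measure (EuclideanSpace ℝ (Fin d ⊕ Fin d)))
    (r := 2 * π) (by positivity) (euclEquiv d ⁻¹' {w | ¬ p w})
  rw [measurePreserving_euclEquiv.measure_preimage_equiv] at h1
  change volume ((fun v => (2 * π) • v) ⁻¹' (euclEquiv d ⁻¹' {w | ¬ p w})) = 0 at h
  rw [h1, mul_eq_zero] at h
  refine h.resolve_left ?_
  rw [ENNReal.ofReal_eq_zero, not_le]
  positivity

theorem invFT_fourierT {a : Pd d → ℂ} (hc : Continuous a) (ha : Integrable a)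
    (hF : Integrable (fourierT a)) : invFT (fourierT a) = a := by
  have h1 : 𝓕 (a ∘ euclEquiv d) = fun v => fourierT a (euclEquiv d ((2 * π) • v)) := by
    ext v; rw [fourierT_euclEquiv]
  have h2 := Continuous.fourierInv_fourier_eq (hc.comp continuous_euclEquiv)
    ((measurePreserving_euclEquiv.integrable_comp_emb (euclEquiv d).measurableEmbedding).2 ha)
    (by rw [h1]; exact integrable_comp_scaled hF)
  ext z
  obtain ⟨x, rfl⟩ := (euclEquiv d).surjective z
  rw [invFT_euclEquiv, ← h1, h2]; rfl

theorem fourierT_invFT_ae_eq {h : Pd d → ℂ} (hh : Integrable h) (hf : Integrable (invFT h)) :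
    fourierT (invFT h) =ᵐ[volume] h := by
  have h1 : invFT h ∘ euclEquiv d = 𝓕⁻ (fun v => h (euclEquiv d ((2 * π) • v))) := by
    ext v; rw [← invFT_euclEquiv]; rfl
  refine ae_of_ae_scaled (p := fun w => fourierT (invFT h) w = h w) ?_
  have h2 := fourier_fourierInv_ae_eq (integrable_comp_scaled hh) (by
    rw [← h1]
    exact (measurePreserving_euclEquiv.integrable_comp_emb
      (euclEquiv d).measurableEmbedding).2 hf)
  filter_upwards [h2] with v hv
  rw [fourierT_euclEquiv, h1, hv]

theorem memLp_two_invFT {h : Pd d → ℂ} (hh : Integrable h) (h2 : MemLp h 2) :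
    MemLp (invFT h) 2 := by
  have h1 : invFT h ∘ euclEquiv d = 𝓕⁻ (fun v => h (euclEquiv d ((2 * π) • v))) := by
    ext v; rw [← invFT_euclEquiv]; rfl
  have hi := integrable_comp_scaled hh
  have h3 : MemLp (invFT h ∘ euclEquiv d) 2 := by
    rw [h1]
    refine memLp_two_fourierInv hi ((memLp_two_iff_integrable_sq_norm hi.1).2 ?_)
    have := (memLp_two_iff_integrable_sq_norm h2.1).1 h2
    have := integrable_comp_scaled (h := fun w => ((‖h w‖ ^ 2 : ℝ) : ℂ)) this.ofReal
    have h4 := this.re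
    exact h4
  rw [← measurePreserving_euclEquiv.map_eq]
  exact ((euclEquiv d).memLp_map_measure_iff).2 h3

end PhaseSpaceFourier

section PhaseSpaceGeometry

variable {d : ℕ}

theorem dotP_add_left (u v z : Pd d) : dotP (u + v) z = dotP u z + dotP v z := by
  simp only [dotP, Prod.fst_add, Prod.snd_add, Pi.add_apply, add_mul, Finset.sum_add_distrib]
  ring

theorem dotP_ex (w : Pd d) (j : Fin d) : dotP w (ex j) = w.1 j := by
  simp [dotP, ex, Pi.single_apply]

theorem dotP_exi (w : Pd d) (j : Fin d) : dotP w (exi j) = w.2 j := by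
  simp [dotP, exi, Pi.single_apply]

theorem normP_euclEquiv (x : EuclideanSpace ℝ (Fin d ⊕ Fin d)) :
    normP (euclEquiv d x) = ‖x‖ := by
  simp [normP, euclEquiv_apply, EuclideanSpace.norm_eq]

theorem normP_nonneg (w : Pd d) : 0 ≤ normP w := Real.sqrt_nonneg _

theorem continuous_normP : Continuous (normP : Pd d → ℝ) := by
  unfold normP; fun_prop

theorem abs_dotP_le (u v : Pd d) : |dotP u v| ≤ normP u * normP v := by
  obtain ⟨x, rfl⟩ := (euclEquiv d).surjective u
  obtain ⟨y, rfl⟩ := (euclEquiv d).surjective v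
  rw [dotP_euclEquiv, normP_euclEquiv, normP_euclEquiv]
  exact abs_real_inner_le_norm x y

theorem normP_add_le (u v : Pd d) : normP (u + v) ≤ normP u + normP v := by
  obtain ⟨x, rfl⟩ := (euclEquiv d).surjective u
  obtain ⟨y, rfl⟩ := (euclEquiv d).surjective v
  have : euclEquiv d x + euclEquiv d y = euclEquiv d (x + y) := rfl
  rw [this]
  simp only [normP_euclEquiv]
  exact norm_add_le x y

theorem normP_sub_le (u v : Pd d) : normP (u - v) ≤ normP u + normP v := by
  have h := normP_add_le u (-v)
  have h' : normP (-v) = normP v := by simp [normP]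
  rwa [h', ← sub_eq_add_neg] at h

theorem abs_fst_le_normP (w : Pd d) (j : Fin d) : |w.1 j| ≤ normP w := by
  have h := abs_dotP_le w (ex j)
  have h' : normP (ex j : Pd d) = 1 := by simp [normP, ex, Pi.single_apply]
  rwa [dotP_ex, h', mul_one] at h

theorem abs_snd_le_normP (w : Pd d) (j : Fin d) : |w.2 j| ≤ normP w := by
  have h := abs_dotP_le w (exi j)
  have h' : normP (exi j : Pd d) = 1 := by simp [normP, exi, Pi.single_apply]
  rwa [dotP_exi, h', mul_one] at h

theorem norm_le_normP (w : Pd d) : ‖w‖ ≤ normP w :=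
  max_le ((pi_norm_le_iff_of_nonneg (normP_nonneg w)).2 (abs_fst_le_normP w))
    ((pi_norm_le_iff_of_nonneg (normP_nonneg w)).2 (abs_snd_le_normP w))

theorem abs_symp_le (u v : Pd d) : |symp u v| ≤ normP u * normP v := by
  have h := abs_dotP_le (u.2, -u.1) v
  have h1 : normP ((u.2, -u.1) : Pd d) = normP u := by simp [normP, add_comm]
  have h2 : dotP (u.2, -u.1) v = symp u v := by
    simp [dotP, symp, sub_eq_add_neg]
  rwa [h1, h2] at h

/-- The inner product `dotP` as a continuous bilinear map. -/
def dotB (d : ℕ) : Pd d →L[ℝ] Pd d →L[ℝ] ℝ :=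
  (LinearMap.mk₂ ℝ dotP dotP_add_left
    (fun c u v => by simp [dotP, Finset.mul_sum, mul_add, mul_assoc])
    (fun u v w => by
      simp only [dotP, Prod.fst_add, Prod.snd_add, Pi.add_apply, mul_add, Finset.sum_add_distrib]
      ring)
    (fun c u v => by simp [dotP, Finset.mul_sum, mul_add, mul_left_comm])).toContinuousBilinearMap

end PhaseSpaceGeometry

section Derivative

variable {d : ℕ}

theorem cexp_eq_fourierChar (L : ℝ) (h : ℂ) :
    Complex.exp (Complex.I * (L : ℂ)) * h = Real.fourierChar (-(-(2 * π)⁻¹ * L)) • h := by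
  rw [Circle.smul_def, Real.fourierChar_apply, smul_eq_mul]
  congr 2
  push_cast
  have : (π : ℂ) ≠ 0 := by exact_mod_cast Real.pi_ne_zero
  field_simp

theorem invFT_eq_fourierIntegral (h : Pd d → ℂ) : invFT h = fun z =>
    (((2 * Real.pi) ^ (2 * d) : ℝ) : ℂ)⁻¹ * VectorFourier.fourierIntegral Real.fourierChar volume
      ((-(2 * π)⁻¹ : ℝ) • dotB d).toLinearMap₁₂ h z := by
  ext z
  rw [invFT, VectorFourier.fourierIntegral]
  congr 2; ext w
  rw [cexp_eq_fourierChar]; rfl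

theorem continuous_invFT {h : Pd d → ℂ} (hh : Integrable h) : Continuous (invFT h) := by
  rw [invFT_eq_fourierIntegral]
  exact continuous_const.mul (VectorFourier.fourierIntegral_continuous
    Real.continuous_fourierChar ((-(2 * π)⁻¹ : ℝ) • dotB d).continuous₂ hh)

theorem hasFDerivAt_invFT {h : Pd d → ℂ} (hh : Integrable h)
    (hh' : Integrable fun w => normP w * ‖h w‖) (z : Pd d) :
    ∃ L : Pd d →L[ℝ] ℂ, HasFDerivAt (invFT h) L z ∧
      ∀ v, L v = invFT (fun w => Complex.I * dotP w v * h w) z := by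
  have h1 : Integrable fun w => ‖w‖ * ‖h w‖ := by
    refine hh'.mono' (continuous_norm.aestronglyMeasurable.mul hh.1.norm) (.of_forall fun w => ?_)
    rw [norm_mul, norm_norm, norm_norm]
    gcongr; exact norm_le_normP w
  set B := ((-(2 * π)⁻¹ : ℝ) • dotB d)
  have h2 := VectorFourier.hasFDerivAt_fourierIntegral B hh h1 z
  have h3 := h2.const_mul (((2 * Real.pi) ^ (2 * d) : ℝ) : ℂ)⁻¹
  rw [invFT_eq_fourierIntegral]
  refine ⟨_, h3, fun v => ?_⟩
  have hi : Integrable (VectorFourier.fourierSMulRight B h) :=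
    by
    refine (h1.const_mul (2 * π * ‖B‖)).mono' hh.1.fourierSMulRight (.of_forall fun w => ?_)
    rw [← mul_assoc (2 * π * ‖B‖)]; exact VectorFourier.norm_fourierSMulRight_le B h w
  rw [_root_.smul_apply, fourierIntegral_continuousLinearMap_apply' hi,
    invFT_eq_fourierIntegral, smul_eq_mul]
  congr 2; ext w
  rw [VectorFourier.fourierSMulRight_apply]
  have e : B w v = -(2 * π)⁻¹ * dotP w v := rfl
  rw [e, Complex.real_smul, smul_eq_mul]
  have : (π : ℂ) ≠ 0 := by exact_mod_cast Real.pi_ne_zero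
  push_cast
  field_simp

theorem pdC_invFT {h : Pd d → ℂ} (hh : Integrable h)
    (hh' : Integrable fun w => normP w * ‖h w‖) (v z : Pd d) :
    pdC v (invFT h) z = invFT (fun w => Complex.I * dotP w v * h w) z := by
  obtain ⟨L, hL, hv⟩ := hasFDerivAt_invFT hh hh' z
  rw [pdC, hL.fderiv, hv]

end Derivative

section Products

variable {d : ℕ}

instance isAddHaarMeasure_volume_phaseSpace : (volume : Measure (Pd d)).IsAddHaarMeasure :=
  Measure.prod.instIsAddHaarMeasure _ _

/-- The twisted convolution representing the Poisson bracket on the Fourier side. -/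
def poissonConv (g h : Pd d → ℂ) (w : Pd d) : ℂ :=
  -(((2 * Real.pi) ^ (2 * d) : ℝ) : ℂ)⁻¹ * ∫ u, (symp u (w - u) : ℂ) * g u * h (w - u)

theorem integrable_cexp_mul {h : Pd d → ℂ} (hh : Integrable h) (z : Pd d) :
    Integrable fun w => Complex.exp (Complex.I * dotP w z) * h w := by
  have hc : Continuous fun w : Pd d => Complex.exp (Complex.I * (dotP w z : ℂ)) := by
    have := continuous_dotP_left z
    fun_prop
  refine hh.mono (hc.aestronglyMeasurable.mul hh.1) (.of_forall fun w => ?_)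
  rw [norm_mul, mul_comm Complex.I, Complex.norm_exp_ofReal_mul_I, one_mul]

theorem invFT_mul_invFT {g h : Pd d → ℂ} (hg : Integrable g) (hh : Integrable h) (z : Pd d) :
    invFT g z * invFT h z = invFT (fun w =>
      (((2 * Real.pi) ^ (2 * d) : ℝ) : ℂ)⁻¹ * ∫ u, g u * h (w - u)) z := by
  have h1 := integral_convolution (ContinuousLinearMap.mul ℝ ℂ)
    (integrable_cexp_mul hg z) (integrable_cexp_mul hh z)
  simp only [ContinuousLinearMap.mul_apply'] at h1
  simp only [invFT]
  rw [mul_mul_mul_comm, ← h1, mul_assoc]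
  congr 1
  rw [← integral_const_mul]
  congr 1; ext w
  rw [convolution_def, mul_left_comm, ← integral_const_mul (Complex.exp _)]
  congr 2; ext u
  simp only [ContinuousLinearMap.mul_apply']
  have : dotP w z = dotP u z + dotP (w - u) z := by rw [← dotP_add_left]; simp
  rw [this, Complex.ofReal_add, mul_add, Complex.exp_add]
  ring

theorem ae_integrable_conv {g h : Pd d → ℂ} (hg : Integrable g) (hh : Integrable h) :
    ∀ᵐ w, Integrable fun u => g u * h (w - u) :=
  hg.ae_convolution_exists (ContinuousLinearMap.mul ℝ ℂ) hh

theorem integrable_conv {g h : Pd d → ℂ} (hg : Integrable g) (hh : Integrable h) :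
    Integrable fun w => ∫ u, g u * h (w - u) :=
  hg.integrable_convolution (ContinuousLinearMap.mul ℝ ℂ) hh

theorem integrable_dotP_mul {h : Pd d → ℂ} (hh : Integrable h)
    (hh' : Integrable fun w => normP w * ‖h w‖) (v : Pd d) :
    Integrable fun w => Complex.I * dotP w v * h w := by
  refine (hh'.const_mul (normP v)).mono' ?_ (.of_forall fun w => ?_)
  · have hc : Continuous fun w : Pd d => Complex.I * (dotP w v : ℂ) := by
      have := continuous_dotP_left v
      fun_prop
    exact hc.aestronglyMeasurable.mul hh.1
  · rw [norm_mul, norm_mul, Complex.norm_I, one_mul, Complex.norm_real, Real.norm_eq_abs,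
      ← mul_assoc, mul_comm (normP v)]
    gcongr
    exact abs_dotP_le w v

theorem invFT_sub {g h : Pd d → ℂ} (hg : Integrable g) (hh : Integrable h) (z : Pd d) :
    invFT (fun w => g w - h w) z = invFT g z - invFT h z := by
  simp only [invFT, mul_sub]
  rw [integral_sub (integrable_cexp_mul hg z) (integrable_cexp_mul hh z), mul_sub]

theorem invFT_sum {ι : Type*} (s : Finset ι) {g : ι → Pd d → ℂ}
    (hg : ∀ i ∈ s, Integrable (g i)) (z : Pd d) :
    invFT (fun w => ∑ i ∈ s, g i w) z = ∑ i ∈ s, invFT (g i) z := by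
  simp only [invFT, Finset.mul_sum]
  rw [integral_finsetSum s fun i hi => integrable_cexp_mul (hg i hi) z, Finset.mul_sum]

theorem invFT_congr_ae {g h : Pd d → ℂ} (hgh : g =ᵐ[volume] h) (z : Pd d) :
    invFT g z = invFT h z := by
  rw [invFT, invFT]
  congr 1
  refine integral_congr_ae ?_
  filter_upwards [hgh] with w hw
  rw [hw]

theorem sum_invFT_mul_sub {ι : Type*} [Fintype ι] {p q r s : ι → Pd d → ℂ}
    (hp : ∀ j, Integrable (p j)) (hq : ∀ j, Integrable (q j)) (hr : ∀ j, Integrable (r j))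
    (hs : ∀ j, Integrable (s j)) (z : Pd d) :
    ∑ j, (invFT (p j) z * invFT (q j) z - invFT (r j) z * invFT (s j) z) =
      invFT (fun w => (((2 * Real.pi) ^ (2 * d) : ℝ) : ℂ)⁻¹ *
        ∫ u, ∑ j, (p j u * q j (w - u) - r j u * s j (w - u))) z := by
  set c : ℂ := (((2 * Real.pi) ^ (2 * d) : ℝ) : ℂ)⁻¹
  have h1 : ∀ j, Integrable fun w => c * ∫ u, p j u * q j (w - u) := fun j =>
    (integrable_conv (hp j) (hq j)).const_mul c
  have h2 : ∀ j, Integrable fun w => c * ∫ u, r j u * s j (w - u) := fun j =>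
    (integrable_conv (hr j) (hs j)).const_mul c
  have h3 : ∀ j, Integrable fun w => (c * ∫ u, p j u * q j (w - u)) -
      c * ∫ u, r j u * s j (w - u) := fun j => (h1 j).sub (h2 j)
  have h4 : ∀ j, invFT (p j) z * invFT (q j) z - invFT (r j) z * invFT (s j) z =
      invFT (fun w => (c * ∫ u, p j u * q j (w - u)) - c * ∫ u, r j u * s j (w - u)) z := by
    intro j
    rw [invFT_sub (h1 j) (h2 j), invFT_mul_invFT (hp j) (hq j), invFT_mul_invFT (hr j) (hs j)]
  rw [Finset.sum_congr rfl fun j _ => h4 j, ← invFT_sum _ fun j _ => h3 j]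
  refine invFT_congr_ae ?_ z
  filter_upwards [ae_all_iff.2 fun j => ae_integrable_conv (hp j) (hq j),
    ae_all_iff.2 fun j => ae_integrable_conv (hr j) (hs j)] with w h5 h6
  have h7 : ∀ j, Integrable fun u => p j u * q j (w - u) - r j u * s j (w - u) :=
    fun j => (h5 j).sub (h6 j)
  rw [integral_finsetSum _ fun j _ => h7 j, Finset.mul_sum]
  refine Finset.sum_congr rfl fun j _ => ?_
  rw [integral_sub (h5 j) (h6 j), mul_sub]

/-- The Poisson bracket of two inverse Fourier transforms. -/
theorem sum_invFT_mul_eq_invFT_poissonConv {g h : Pd d → ℂ} (hg : Integrable g)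
    (hg' : Integrable fun w => normP w * ‖g w‖) (hh : Integrable h)
    (hh' : Integrable fun w => normP w * ‖h w‖) (z : Pd d) :
    ∑ j, (invFT (fun w => Complex.I * dotP w (exi j) * g w) z *
            invFT (fun w => Complex.I * dotP w (ex j) * h w) z -
          invFT (fun w => Complex.I * dotP w (ex j) * g w) z *
            invFT (fun w => Complex.I * dotP w (exi j) * h w) z) =
      invFT (poissonConv g h) z := by
  have ig := fun v => integrable_dotP_mul hg hg' v
  have ih := fun v => integrable_dotP_mul hh hh' v
  rw [sum_invFT_mul_sub (fun j => ig (exi j)) (fun j => ih (ex j)) (fun j => ig (ex j))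
    (fun j => ih (exi j))]
  congr 1; ext w
  rw [poissonConv, neg_mul, ← mul_neg, ← integral_neg]
  congr 2; ext u
  simp only [dotP_ex, dotP_exi, symp]
  push_cast
  rw [← Finset.sum_sub_distrib, Finset.sum_mul, Finset.sum_mul, ← Finset.sum_neg_distrib]
  refine Finset.sum_congr rfl fun j _ => ?_
  linear_combination (g u * h (w - u) * ((u.2 j : ℂ) * (w - u).1 j -
    u.1 j * (w - u).2 j)) * Complex.I_mul_I

end Products

section WeightedNorm

variable {d : ℕ}

/-- The weighted `L¹` norm with exponential weight of rate `s`. -/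
def wnorm (s : ℝ) (h : Pd d → ℂ) : ℝ≥0∞ :=
  ∫⁻ w, ‖h w‖ₑ * ENNReal.ofReal (Real.exp (s * normP w))

theorem Anorm_eq_wnorm (s : ℝ) (a : Pd d → ℂ) : Anorm s a = wnorm s (fourierT a) := by
  unfold Anorm wnorm
  congr 1; ext w
  rw [ENNReal.ofReal_mul (norm_nonneg _), ofReal_norm]

theorem wnorm_mono {s s' : ℝ} (hs : s ≤ s') (h : Pd d → ℂ) : wnorm s h ≤ wnorm s' h := by
  refine lintegral_mono fun w => ?_
  have := normP_nonneg w
  gcongr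

theorem wnorm_zero (h : Pd d → ℂ) : wnorm 0 h = ∫⁻ w, ‖h w‖ₑ := by
  simp [wnorm]

theorem wnorm_congr_ae {s : ℝ} {g h : Pd d → ℂ} (hgh : g =ᵐ[volume] h) :
    wnorm s g = wnorm s h := by
  refine lintegral_congr_ae ?_
  filter_upwards [hgh] with w hw
  rw [hw]

theorem wnorm_const_mul (s : ℝ) (c : ℂ) (h : Pd d → ℂ) :
    wnorm s (fun w => c * h w) = ‖c‖ₑ * wnorm s h := by
  unfold wnorm
  rw [← lintegral_const_mul' _ _ enorm_ne_top]
  congr 1; ext w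
  rw [enorm_mul, mul_assoc]

theorem integrable_of_norm_le_exp_mul {F : Type*} [NormedAddCommGroup F] {s C : ℝ}
    {h : Pd d → ℂ} (hh : wnorm s h < ⊤) {f : Pd d → F} (hf : AEStronglyMeasurable f volume)
    (hfh : ∀ w, ‖f w‖ ≤ C * Real.exp (s * normP w) * ‖h w‖) : Integrable f := by
  refine ⟨hf, ?_⟩
  calc ∫⁻ w, ‖f w‖ₑ
      ≤ ∫⁻ w, ENNReal.ofReal C * (‖h w‖ₑ * ENNReal.ofReal (Real.exp (s * normP w))) := by
        refine lintegral_mono fun w => ?_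
        rw [← ofReal_norm, ← ofReal_norm,
          ← ENNReal.ofReal_mul (norm_nonneg _), ← ENNReal.ofReal_mul' (by positivity)]
        refine ENNReal.ofReal_le_ofReal ((hfh w).trans (le_of_eq ?_))
        ring
    _ = ENNReal.ofReal C * wnorm s h := lintegral_const_mul' _ _ ENNReal.ofReal_ne_top
    _ < ⊤ := ENNReal.mul_lt_top ENNReal.ofReal_lt_top hh

theorem integrable_of_wnorm_lt_top {s : ℝ} (hs : 0 ≤ s) {h : Pd d → ℂ}
    (hm : AEStronglyMeasurable h volume) (hh : wnorm s h < ⊤) : Integrable h := by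
  refine integrable_of_norm_le_exp_mul (C := 1) hh hm fun w => ?_
  have h1 : 1 ≤ Real.exp (s * normP w) := Real.one_le_exp (mul_nonneg hs (normP_nonneg w))
  rw [one_mul]
  exact le_mul_of_one_le_left (norm_nonneg _) h1

theorem mul_exp_le {r δ : ℝ} (hδ : 0 < δ) (x : ℝ) :
    x * Real.exp (r * x) ≤ (Real.exp 1 * δ)⁻¹ * Real.exp ((r + δ) * x) := by
  have h1 : δ * x ≤ Real.exp (δ * x - 1) := by linarith [Real.add_one_le_exp (δ * x - 1)]
  have h2 : x ≤ (Real.exp 1 * δ)⁻¹ * Real.exp (δ * x) := by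
    rw [Real.exp_sub] at h1
    rw [← div_eq_inv_mul, le_div_iff₀ (by positivity)]
    rw [le_div_iff₀ (by positivity)] at h1
    linarith
  calc x * Real.exp (r * x) ≤ (Real.exp 1 * δ)⁻¹ * Real.exp (δ * x) * Real.exp (r * x) := by
        gcongr
    _ = _ := by rw [mul_assoc, ← Real.exp_add]; ring_nf

theorem one_add_pow_le {δ : ℝ} (hδ : 0 < δ) (n : ℕ) :
    ∃ C : ℝ, 0 ≤ C ∧ ∀ x : ℝ, 0 ≤ x → (1 + x) ^ n ≤ C * Real.exp (δ * x) := by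
  refine ⟨n.factorial * δ⁻¹ ^ n * Real.exp δ, by positivity, fun x hx => ?_⟩
  have h := Real.pow_div_factorial_le_exp (δ * (1 + x)) (by positivity) n
  rw [div_le_iff₀ (by positivity), mul_pow] at h
  have h2 : Real.exp (δ * (1 + x)) = Real.exp δ * Real.exp (δ * x) := by
    rw [← Real.exp_add]; ring_nf
  rw [h2] at h
  calc (1 + x) ^ n = δ⁻¹ ^ n * (δ ^ n * (1 + x) ^ n) := by
        rw [← mul_assoc, ← mul_pow, inv_mul_cancel₀ hδ.ne', one_pow, one_mul]
    _ ≤ δ⁻¹ ^ n * (Real.exp δ * Real.exp (δ * x) * n.factorial) := by gcongr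
    _ = _ := by ring

theorem integrable_one_add_pow_mul {s : ℝ} (hs : 0 < s) {h : Pd d → ℂ}
    (hm : AEStronglyMeasurable h volume) (hh : wnorm s h < ⊤) (n : ℕ) :
    Integrable fun w => (1 + normP w) ^ n * ‖h w‖ := by
  obtain ⟨C, -, hC⟩ := one_add_pow_le hs n
  have hc : Continuous fun w : Pd d => (1 + normP w) ^ n := by
    have := continuous_normP (d := d)
    fun_prop
  refine integrable_of_norm_le_exp_mul (C := C) hh (hc.aestronglyMeasurable.mul hm.norm)
    fun w => ?_
  have := normP_nonneg w
  rw [Real.norm_of_nonneg (by positivity)]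
  gcongr
  exact hC _ this

theorem integrable_normP_mul {s : ℝ} (hs : 0 < s) {h : Pd d → ℂ}
    (hm : AEStronglyMeasurable h volume) (hh : wnorm s h < ⊤) :
    Integrable fun w => normP w * ‖h w‖ := by
  refine (integrable_one_add_pow_mul hs hm hh 1).mono'
    (continuous_normP.aestronglyMeasurable.mul hm.norm) (.of_forall fun w => ?_)
  have := normP_nonneg w
  rw [Real.norm_of_nonneg (by positivity)]
  gcongr
  linarith

theorem continuous_symp_sub : Continuous fun p : Pd d × Pd d => symp p.2 (p.1 - p.2) := by
  unfold symp; fun_prop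

theorem stronglyMeasurable_poissonConv {g h : Pd d → ℂ} (hg : StronglyMeasurable g)
    (hh : StronglyMeasurable h) : StronglyMeasurable (poissonConv g h) := by
  have h1 : StronglyMeasurable fun p : Pd d × Pd d =>
      (symp p.2 (p.1 - p.2) : ℂ) * g p.2 * h (p.1 - p.2) :=
    ((Complex.continuous_ofReal.comp continuous_symp_sub).stronglyMeasurable.mul
      (hg.comp_measurable measurable_snd)).mul (hh.comp_measurable (by fun_prop))
  exact (stronglyMeasurable_const (b := -(((2 * Real.pi) ^ (2 * d) : ℝ) : ℂ)⁻¹)).mul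
    (StronglyMeasurable.integral_prod_right (ν := volume) h1)

theorem stronglyMeasurable_fourierT {a : Pd d → ℂ} (ha : StronglyMeasurable a) :
    StronglyMeasurable (fourierT a) := by
  have hc : Continuous fun p : Pd d × Pd d => Complex.exp (-(Complex.I * (dotP p.1 p.2 : ℂ))) := by
    unfold dotP; fun_prop
  have h1 : StronglyMeasurable fun p : Pd d × Pd d =>
      Complex.exp (-(Complex.I * (dotP p.1 p.2 : ℂ))) * a p.2 :=
    hc.stronglyMeasurable.mul (ha.comp_measurable measurable_snd)
  exact StronglyMeasurable.integral_prod_right (ν := volume) h1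

theorem enorm_inv_two_pi_pow_le (n : ℕ) : ‖(((2 * Real.pi) ^ n : ℝ) : ℂ)⁻¹‖ₑ ≤ 1 := by
  rw [← ofReal_norm, ENNReal.ofReal_le_one, norm_inv, Complex.norm_real,
    Real.norm_of_nonneg (by positivity)]
  exact inv_le_one_of_one_le₀ (one_le_pow₀ (by linarith [Real.pi_gt_three]))

theorem enorm_poissonConv_le (g h : Pd d → ℂ) (w : Pd d) :
    ‖poissonConv g h w‖ₑ ≤ ∫⁻ u, (ENNReal.ofReal (normP u) * ‖g u‖ₑ) *
      (ENNReal.ofReal (normP (w - u)) * ‖h (w - u)‖ₑ) := by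
  rw [poissonConv, enorm_mul, enorm_neg]
  refine (mul_le_of_le_one_left zero_le (enorm_inv_two_pi_pow_le _)).trans ?_
  refine (enorm_integral_le_lintegral_enorm _).trans (lintegral_mono fun u => ?_)
  rw [enorm_mul, enorm_mul]
  have : ‖(symp u (w - u) : ℂ)‖ₑ ≤ ENNReal.ofReal (normP u) * ENNReal.ofReal (normP (w - u)) := by
    rw [← ENNReal.ofReal_mul (normP_nonneg u), ← ofReal_norm, Complex.norm_real]
    exact ENNReal.ofReal_le_ofReal (abs_symp_le u (w - u))
  calc ‖(symp u (w - u) : ℂ)‖ₑ * ‖g u‖ₑ * ‖h (w - u)‖ₑ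
      ≤ ENNReal.ofReal (normP u) * ENNReal.ofReal (normP (w - u)) * ‖g u‖ₑ * ‖h (w - u)‖ₑ := by
        gcongr
    _ = _ := by ring

theorem lintegral_lintegral_mul_sub {p q : Pd d → ℝ≥0∞} (hp : Measurable p) (hq : Measurable q) :
    ∫⁻ w, ∫⁻ u, p u * q (w - u) = (∫⁻ u, p u) * ∫⁻ v, q v := by
  rw [lintegral_lintegral_swap (by fun_prop)]
  have : ∀ u, ∫⁻ w, p u * q (w - u) = p u * ∫⁻ v, q v := fun u => by
    rw [lintegral_const_mul _ (by fun_prop), lintegral_sub_right_eq_self q u]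
  simp only [this]
  exact lintegral_mul_const _ hp

theorem wnorm_poissonConv_le {r δ₁ δ₂ : ℝ} (hr : 0 ≤ r) (h₁ : 0 < δ₁) (h₂ : 0 < δ₂)
    {g h : Pd d → ℂ} (hg : StronglyMeasurable g) (hh : StronglyMeasurable h) :
    wnorm r (poissonConv g h) ≤ (ENNReal.ofReal (Real.exp 1 * δ₁)⁻¹ * wnorm (r + δ₁) g) *
      (ENNReal.ofReal (Real.exp 1 * δ₂)⁻¹ * wnorm (r + δ₂) h) := by
  have key : ∀ {δ : ℝ}, 0 < δ → ∀ f : Pd d → ℂ,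
      ∫⁻ u, ENNReal.ofReal (normP u * Real.exp (r * normP u)) * ‖f u‖ₑ ≤
        ENNReal.ofReal (Real.exp 1 * δ)⁻¹ * wnorm (r + δ) f := by
    intro δ hδ f
    rw [wnorm, ← lintegral_const_mul' _ _ ENNReal.ofReal_ne_top]
    refine lintegral_mono fun u => ?_
    rw [mul_left_comm, ← ENNReal.ofReal_mul (by positivity), mul_comm]
    exact mul_le_mul_right (ENNReal.ofReal_le_ofReal (mul_exp_le hδ _)) _
  have hn : Measurable (normP : Pd d → ℝ) := continuous_normP.measurable
  have hgm := hg.measurable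
  have hhm := hh.measurable
  refine le_trans ?_ (mul_le_mul' (key h₁ g) (key h₂ h))
  rw [← lintegral_lintegral_mul_sub (by fun_prop) (by fun_prop), wnorm]
  refine lintegral_mono fun w => ?_
  refine (mul_le_mul_left (enorm_poissonConv_le g h w) _).trans ?_
  rw [← lintegral_mul_const' _ _ ENNReal.ofReal_ne_top]
  refine lintegral_mono fun u => ?_
  have h3 : Real.exp (r * normP w) ≤ Real.exp (r * normP u) * Real.exp (r * normP (w - u)) := by
    rw [← Real.exp_add, ← mul_add]
    have := normP_add_le u (w - u)
    rw [add_sub_cancel] at this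
    gcongr
  have h4 := ENNReal.ofReal_le_ofReal h3
  rw [ENNReal.ofReal_mul (by positivity)] at h4
  rw [ENNReal.ofReal_mul (normP_nonneg _), ENNReal.ofReal_mul (normP_nonneg _)]
  refine (mul_le_mul_right h4 _).trans (le_of_eq ?_)
  ring

end WeightedNorm

section LieCoefficients

variable {d : ℕ}

/-- The Fourier side of the iterated Poisson adjoint. -/
def lieCoeff (g h : Pd d → ℂ) : ℕ → Pd d → ℂ
  | 0 => h
  | k + 1 => poissonConv g (lieCoeff g h k)

theorem stronglyMeasurable_lieCoeff {g h : Pd d → ℂ} (hg : StronglyMeasurable g)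
    (hh : StronglyMeasurable h) (k : ℕ) : StronglyMeasurable (lieCoeff g h k) := by
  induction k with
  | zero => exact hh
  | succ k ih => exact stronglyMeasurable_poissonConv hg ih

theorem wnorm_lieCoeff_le {s δ : ℝ} (hδ : 0 < δ) {g h : Pd d → ℂ} (hg : StronglyMeasurable g)
    (hh : StronglyMeasurable h) (k : ℕ) (hk : k * δ ≤ s) :
    wnorm (s - k * δ) (lieCoeff g h k) ≤
      ENNReal.ofReal (((Real.exp 1 * δ) ^ 2)⁻¹ ^ k / k.factorial) * wnorm s g ^ k * wnorm s h := by
  induction k with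
  | zero => simp [lieCoeff]
  | succ k ih =>
    push_cast at hk ⊢
    have h1 := wnorm_poissonConv_le (r := s - (k + 1) * δ) (δ₁ := (k + 1) * δ) (δ₂ := δ)
      (by linarith) (by positivity) hδ hg (stronglyMeasurable_lieCoeff hg hh k)
    rw [sub_add_cancel, show s - (k + 1) * δ + δ = s - k * δ by ring] at h1
    refine h1.trans ((mul_le_mul_right (mul_le_mul_right (ih (by linarith)) _) _).trans
      (le_of_eq ?_))
    have h2 : ENNReal.ofReal (((Real.exp 1 * δ) ^ 2)⁻¹ ^ (k + 1) / (k + 1).factorial) =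
        ENNReal.ofReal (Real.exp 1 * ((k + 1) * δ))⁻¹ * ENNReal.ofReal (Real.exp 1 * δ)⁻¹ *
        ENNReal.ofReal (((Real.exp 1 * δ) ^ 2)⁻¹ ^ k / k.factorial) := by
      rw [← ENNReal.ofReal_mul (by positivity), ← ENNReal.ofReal_mul (by positivity)]
      congr 1
      rw [Nat.factorial_succ, pow_succ]
      push_cast
      have := Real.exp_pos 1
      field_simp
    rw [h2, pow_succ]
    ring

theorem ofReal_inv_factorial_mul_wnorm_lieCoeff_le {s σ : ℝ} (hσ : 0 < σ) (hσs : σ ≤ s)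
    {g h : Pd d → ℂ} (hg : StronglyMeasurable g) (hh : StronglyMeasurable h) (k : ℕ) :
    ENNReal.ofReal (k.factorial : ℝ)⁻¹ * wnorm (s - σ) (lieCoeff g h k) ≤
      (ENNReal.ofReal (σ ^ 2)⁻¹ * wnorm s g) ^ k * wnorm s h := by
  rcases Nat.eq_zero_or_pos k with rfl | hk
  · simpa [lieCoeff] using wnorm_mono (by linarith) h
  have hk' : (0 : ℝ) < k := by exact_mod_cast hk
  have h1 := wnorm_lieCoeff_le (s := s) (δ := σ / k) (by positivity) hg hh k
    (by rwa [mul_div_cancel₀ _ hk'.ne'])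
  rw [mul_div_cancel₀ _ hk'.ne'] at h1
  refine (mul_le_mul_right h1 _).trans ?_
  rw [mul_pow (ENNReal.ofReal _), ← mul_assoc, ← mul_assoc, ← ENNReal.ofReal_mul (by positivity),
    ← ENNReal.ofReal_pow (by positivity)]
  refine mul_le_mul_left (mul_le_mul_left (ENNReal.ofReal_le_ofReal ?_) _) _
  have h2 := Real.pow_div_factorial_le_exp (k : ℝ) hk'.le k
  have h3 : (k : ℝ) ^ k / k.factorial / Real.exp 1 ^ k ≤ 1 := by
    rw [div_le_one (by positivity), ← Real.exp_nat_mul, mul_one]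
    exact h2
  have h4 : (k.factorial : ℝ)⁻¹ * (((Real.exp 1 * (σ / k)) ^ 2)⁻¹ ^ k / k.factorial) =
      ((k : ℝ) ^ k / k.factorial / Real.exp 1 ^ k) ^ 2 * (σ ^ 2)⁻¹ ^ k := by
    have := Real.exp_pos 1
    simp only [mul_pow, div_pow, inv_pow, ← pow_mul, mul_comm 2 k]
    field_simp
  rw [h4]
  exact mul_le_of_le_one_left (by positivity) (pow_le_one₀ (by positivity) h3)

theorem wnorm_lieCoeff_lt_top {s σ : ℝ} (hσ : 0 < σ) (hσs : σ ≤ s)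
    {g h : Pd d → ℂ} (hg : StronglyMeasurable g) (hh : StronglyMeasurable h)
    (hgs : wnorm s g < ⊤) (hhs : wnorm s h < ⊤) (k : ℕ) :
    wnorm (s - σ) (lieCoeff g h k) < ⊤ := by
  have h1 : ENNReal.ofReal (k.factorial : ℝ)⁻¹ * wnorm (s - σ) (lieCoeff g h k) < ⊤ :=
    (ofReal_inv_factorial_mul_wnorm_lieCoeff_le hσ hσs hg hh k).trans_lt
      (ENNReal.mul_lt_top (ENNReal.pow_lt_top (ENNReal.mul_lt_top ENNReal.ofReal_lt_top hgs)) hhs)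
  refine ENNReal.lt_top_of_mul_ne_top_right h1.ne ?_
  rw [Ne, ENNReal.ofReal_eq_zero, not_le]
  positivity

theorem tsum_mul_wnorm_lieCoeff_lt_top {s σ t : ℝ} (hσ : 0 < σ) (hσs : σ ≤ s)
    {g h : Pd d → ℂ} (hg : StronglyMeasurable g) (hh : StronglyMeasurable h)
    (hhs : wnorm s h < ⊤)
    (ht : ENNReal.ofReal |t| * wnorm s g < ENNReal.ofReal (σ ^ 2 / 2)) :
    ∑' k : ℕ, ENNReal.ofReal (|t| ^ k / k.factorial) * wnorm (s - σ) (lieCoeff g h k) < ⊤ := by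
  set q : ℝ≥0∞ := ENNReal.ofReal (σ ^ 2)⁻¹ * (ENNReal.ofReal |t| * wnorm s g)
  have hq : q < 1 := by
    calc q ≤ ENNReal.ofReal (σ ^ 2)⁻¹ * ENNReal.ofReal (σ ^ 2 / 2) := mul_le_mul_right ht.le _
      _ = ENNReal.ofReal (1 / 2) := by
        rw [← ENNReal.ofReal_mul (by positivity)]
        congr 1
        field_simp
      _ < 1 := ENNReal.ofReal_lt_one.2 (by norm_num)
  have hle : ∀ k : ℕ, ENNReal.ofReal (|t| ^ k / k.factorial) * wnorm (s - σ) (lieCoeff g h k) ≤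
      q ^ k * wnorm s h := fun k => by
    rw [div_eq_mul_inv, ENNReal.ofReal_mul (by positivity), ENNReal.ofReal_pow (abs_nonneg t),
      mul_assoc]
    refine (mul_le_mul_right (ofReal_inv_factorial_mul_wnorm_lieCoeff_le hσ hσs hg hh k) _).trans
      (le_of_eq ?_)
    rw [← mul_assoc, ← mul_pow]
    congr 2
    ring
  refine (ENNReal.tsum_le_tsum hle).trans_lt ?_
  rw [ENNReal.tsum_mul_right, ENNReal.tsum_geometric]
  exact ENNReal.mul_lt_top (ENNReal.inv_lt_top.2 (tsub_pos_of_lt hq)) hhs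

theorem ofReal_fderiv_eq_invFT {G : Pd d → ℝ} {g : Pd d → ℂ}
    (hG : (fun z => (G z : ℂ)) = invFT g) (hg : Integrable g)
    (hg' : Integrable fun w => normP w * ‖g w‖) (v z : Pd d) :
    (fderiv ℝ G z v : ℂ) = invFT (fun w => Complex.I * dotP w v * g w) z := by
  obtain ⟨L, hL, hv⟩ := hasFDerivAt_invFT hg hg' z
  rw [← hG] at hL
  have h1 : HasFDerivAt G (Complex.reCLM.comp L) z := by
    simpa using! Complex.reCLM.hasFDerivAt.comp z hL
  have h2 := (Complex.ofRealCLM.hasFDerivAt.comp z h1).unique hL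
  rw [← hv, h1.fderiv, ← h2]
  rfl

theorem poissonR_invFT {G : Pd d → ℝ} {g h : Pd d → ℂ}
    (hG : (fun z => (G z : ℂ)) = invFT g) (hg : Integrable g)
    (hg' : Integrable fun w => normP w * ‖g w‖) (hh : Integrable h)
    (hh' : Integrable fun w => normP w * ‖h w‖) :
    poissonR G (invFT h) = invFT (poissonConv g h) := by
  ext z
  rw [← sum_invFT_mul_eq_invFT_poissonConv hg hg' hh hh' z, poissonR]
  simp only [ofReal_fderiv_eq_invFT hG hg hg', pdC_invFT hh hh']

theorem adP_eq_invFT_lieCoeff {G : Pd d → ℝ} {g h : Pd d → ℂ}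
    (hG : (fun z => (G z : ℂ)) = invFT g) (hg : Integrable g)
    (hg' : Integrable fun w => normP w * ‖g w‖) (hh : ∀ k, Integrable (lieCoeff g h k))
    (hh' : ∀ k, Integrable fun w => normP w * ‖lieCoeff g h k w‖) (k : ℕ) :
    adP G k (invFT h) = invFT (lieCoeff g h k) := by
  induction k with
  | zero => rfl
  | succ k ih => rw [adP, ih, poissonR_invFT hG hg hg' (hh k) (hh' k), lieCoeff]

end LieCoefficients

section Flow

variable {d : ℕ}

theorem norm_sub_taylor_le_of_nonneg {f : ℕ → ℝ → ℂ} {C : ℝ} {n : ℕ}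
    (hf : ∀ j t, HasDerivAt (f j) (f (j + 1) t) t) (hC : ∀ t, ‖f n t‖ ≤ C) {t : ℝ} (ht : 0 ≤ t) :
    ‖f 0 t - ∑ j ∈ Finset.range n, ((t ^ j / (j.factorial : ℝ) : ℝ) : ℂ) * f j 0‖ ≤
      C * (t ^ n / n.factorial) := by
  induction n generalizing f t with
  | zero => simpa using hC t
  | succ n ih =>
    have hmon : ∀ (j : ℕ) (x : ℝ), HasDerivAt (fun x : ℝ => x ^ (j + 1) / ((j + 1).factorial : ℝ))
        (x ^ j / (j.factorial : ℝ)) x := fun j x => by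
      convert! (hasDerivAt_pow (j + 1) x).div_const ((j + 1).factorial : ℝ) using 1
      rw [Nat.factorial_succ]
      push_cast
      field_simp
    have hder : ∀ x : ℝ, HasDerivAt (fun x => f 0 x - ∑ j ∈ Finset.range (n + 1),
        ((x ^ j / (j.factorial : ℝ) : ℝ) : ℂ) * f j 0)
        (f 1 x - ∑ j ∈ Finset.range n, ((x ^ j / (j.factorial : ℝ) : ℝ) : ℂ) * f (j + 1) 0) x := by
      intro x
      refine (hf 0 x).sub ?_
      simp only [Finset.sum_range_succ' _ n]
      have h1 := HasDerivAt.fun_sum (u := Finset.range n) fun j _ =>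
        ((hmon j x).ofReal_comp).mul_const (f (j + 1) 0)
      simpa using! h1.add_const (f 0 0)
    have hB : ∀ x : ℝ, HasDerivAt (fun x => C * (x ^ (n + 1) / ((n + 1).factorial : ℝ)))
        (C * (x ^ n / n.factorial)) x := fun x => (hmon n x).const_mul C
    refine image_norm_le_of_norm_deriv_right_le_deriv_boundary (a := 0) (b := t)
      (fun x _ => (hder x).continuousAt.continuousWithinAt)
      (fun x _ => (hder x).hasDerivWithinAt) ?_ hB ?_ ⟨ht, le_rfl⟩
    · simp [Finset.sum_range_succ']
    · intro x hx
      exact ih (f := fun j => f (j + 1)) (fun j => hf (j + 1)) hC hx.1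

theorem norm_sub_taylor_le {f : ℕ → ℝ → ℂ} {C : ℝ} {n : ℕ}
    (hf : ∀ j t, HasDerivAt (f j) (f (j + 1) t) t) (hC : ∀ t, ‖f n t‖ ≤ C) (t : ℝ) :
    ‖f 0 t - ∑ j ∈ Finset.range n, ((t ^ j / (j.factorial : ℝ) : ℝ) : ℂ) * f j 0‖ ≤
      C * (|t| ^ n / n.factorial) := by
  rcases le_total 0 t with ht | ht
  · rw [abs_of_nonneg ht]
    exact norm_sub_taylor_le_of_nonneg hf hC ht
  · rw [abs_of_nonpos ht]
    have h := norm_sub_taylor_le_of_nonneg (f := fun j x => (-1) ^ j * f j (-x)) (n := n) (C := C)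
      (fun j x => ?_) (fun x => by simpa using hC (-x)) (neg_nonneg.2 ht)
    · convert! h using 2
      simp only [neg_neg, pow_zero, one_mul, neg_zero]
      congr 1
      refine Finset.sum_congr rfl fun j _ => ?_
      rw [← mul_assoc]
      congr 1
      push_cast
      rw [neg_pow (t : ℂ), div_mul_eq_mul_div, mul_right_comm, ← mul_pow]
      simp
    · have h1 := ((hf j (-x)).scomp x (hasDerivAt_neg x)).const_mul ((-1 : ℂ) ^ j)
      convert! h1 using 1
      simp [pow_succ]

theorem fderiv_hamVF (G : Pd d → ℝ) (b : Pd d → ℂ) (p : Pd d) :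
    fderiv ℝ b p (hamVF G p) = poissonR G b p := by
  have h : hamVF G p = ∑ j, (fderiv ℝ G p (exi j) • (ex j : Pd d) -
      fderiv ℝ G p (ex j) • (exi j : Pd d)) := by
    refine Prod.ext ?_ ?_ <;> ext i <;>
      simp [hamVF, ex, exi, Prod.fst_sum, Prod.snd_sum, Finset.sum_apply, Pi.single_apply]
  rw [h, map_sum, poissonR]
  simp [pdC]

theorem enorm_invFT_le (h : Pd d → ℂ) (z : Pd d) : ‖invFT h z‖ₑ ≤ ∫⁻ w, ‖h w‖ₑ := by
  rw [invFT, enorm_mul]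
  refine (mul_le_of_le_one_left zero_le (enorm_inv_two_pi_pow_le _)).trans ?_
  refine (enorm_integral_le_lintegral_enorm _).trans (lintegral_mono fun w => ?_)
  rw [enorm_mul, ← ofReal_norm (Complex.exp _), mul_comm Complex.I, Complex.norm_exp_ofReal_mul_I]
  simp

theorem hasSum_taylor_comp_flow {G : Pd d → ℝ} {b : ℕ → Pd d → ℂ} {φ : ℝ → Pd d → Pd d}
    (hφ0 : ∀ z, φ 0 z = z)
    (hφ : ∀ (t : ℝ) (z : Pd d), HasDerivAt (fun τ => φ τ z) (hamVF G (φ t z)) t)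
    (hb : ∀ j z, DifferentiableAt ℝ (b j) z) (hbG : ∀ j, poissonR G (b j) = b (j + 1)) {t : ℝ}
    {C : ℕ → ℝ} (hC : ∀ j z, ‖b j z‖ ≤ C j) (hsum : Summable fun j => |t| ^ j / j.factorial * C j)
    (z : Pd d) :
    HasSum (fun j => ((t ^ j / (j.factorial : ℝ) : ℝ) : ℂ) * b j z) (b 0 (φ t z)) := by
  have hder : ∀ j τ, HasDerivAt (fun τ => b j (φ τ z)) (b (j + 1) (φ τ z)) τ := fun j τ => by
    have h := (hb j (φ τ z)).hasFDerivAt.comp_hasDerivAt τ (hφ τ z)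
    rwa [fderiv_hamVF, hbG] at h
  have hs : Summable fun j => ((t ^ j / (j.factorial : ℝ) : ℝ) : ℂ) * b j z := by
    refine hsum.of_norm_bounded fun j => ?_
    rw [norm_mul, Complex.norm_real, norm_div, norm_pow, Real.norm_natCast, Real.norm_eq_abs]
    gcongr
    exact hC j z
  refine (hs.hasSum_iff_tendsto_nat).2 ?_
  rw [tendsto_iff_norm_sub_tendsto_zero]
  refine squeeze_zero (fun _ => norm_nonneg _) (fun n => ?_) hsum.tendsto_atTop_zero
  have h := norm_sub_taylor_le (f := fun j τ => b j (φ τ z)) (n := n) hder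
    (fun τ => hC n (φ τ z)) t
  simp only [hφ0] at h
  rw [norm_sub_rev, mul_comm]
  exact h

end Flow

section Series

variable {d : ℕ}

theorem wnorm_tsum_le {r : ℝ} {H : ℕ → Pd d → ℂ} (hm : ∀ j, StronglyMeasurable (H j)) :
    wnorm r (fun w => ∑' j, H j w) ≤ ∑' j, wnorm r (H j) := by
  have hn : Measurable (normP : Pd d → ℝ) := continuous_normP.measurable
  have hm' := fun j => (hm j).measurable
  simp only [wnorm]
  rw [← lintegral_tsum fun j => by fun_prop]
  refine lintegral_mono fun w => ?_
  rw [ENNReal.tsum_mul_right]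
  exact mul_le_mul_left enorm_tsum_le_tsum_enorm _

theorem wnorm_zero_le {r : ℝ} (hr : 0 ≤ r) (h : Pd d → ℂ) : ∫⁻ w, ‖h w‖ₑ ≤ wnorm r h := by
  rw [← wnorm_zero]
  exact wnorm_mono hr h

theorem aestronglyMeasurable_tsum {H : ℕ → Pd d → ℂ} (hm : ∀ j, StronglyMeasurable (H j))
    (hs : ∑' j, ∫⁻ w, ‖H j w‖ₑ < ⊤) : AEStronglyMeasurable (fun w => ∑' j, H j w) volume := by
  have hm' := fun j => (hm j).measurable
  rw [← lintegral_tsum fun j => by fun_prop] at hs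
  have hae := ae_lt_top (by fun_prop) hs.ne
  refine aestronglyMeasurable_of_tendsto_ae atTop
    (f := fun n w => ∑ j ∈ Finset.range n, H j w)
    (fun n => (Finset.stronglyMeasurable_fun_sum _ fun j _ => hm j).aestronglyMeasurable) ?_
  filter_upwards [hae] with w hw
  have h1 : Summable fun j => ‖H j w‖ := by
    simpa using! ENNReal.summable_toReal hw.ne
  exact h1.of_norm.hasSum.tendsto_sum_nat

theorem hasSum_invFT {H : ℕ → Pd d → ℂ} (hm : ∀ j, StronglyMeasurable (H j))
    (hs : ∑' j, ∫⁻ w, ‖H j w‖ₑ < ⊤) (z : Pd d) :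
    HasSum (fun j => invFT (H j) z) (invFT (fun w => ∑' j, H j w) z) := by
  have hi : ∀ j, Integrable (H j) := fun j =>
    ⟨(hm j).aestronglyMeasurable, (ENNReal.le_tsum j).trans_lt hs⟩
  have h1 := hasSum_integral_of_summable_integral_norm
    (fun j => integrable_cexp_mul (hi j) z) (by
      have h2 := ENNReal.summable_toReal hs.ne
      refine h2.congr fun j => ?_
      rw [← integral_norm_eq_lintegral_enorm (hi j).1]
      congr 1; ext w
      rw [norm_mul, mul_comm Complex.I, Complex.norm_exp_ofReal_mul_I, one_mul])
  simp only [tsum_mul_left] at h1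
  exact h1.mul_left _

theorem lintegral_enorm_dotP_mul_le {r : ℝ} (hr : 0 < r) (v : Pd d) : ∃ C : ℝ, ∀ h : Pd d → ℂ,
    ∫⁻ w, ‖Complex.I * dotP w v * h w‖ₑ ≤ ENNReal.ofReal C * wnorm r h := by
  obtain ⟨C, hC0, hC⟩ := one_add_pow_le hr 1
  refine ⟨C * normP v, fun h => ?_⟩
  rw [wnorm, ← lintegral_const_mul' _ _ ENNReal.ofReal_ne_top]
  refine lintegral_mono fun w => ?_
  rw [enorm_mul, mul_comm ‖h w‖ₑ, ← mul_assoc, ← ENNReal.ofReal_mul' (by positivity)]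
  refine mul_le_mul_left ?_ _
  rw [← ofReal_norm]
  refine ENNReal.ofReal_le_ofReal ?_
  rw [norm_mul, Complex.norm_I, one_mul, Complex.norm_real]
  have h1 := hC _ (normP_nonneg w)
  have := normP_nonneg v
  calc ‖dotP w v‖ ≤ normP w * normP v := abs_dotP_le w v
    _ ≤ C * Real.exp (r * normP w) * normP v := by gcongr; linarith
    _ = _ := by ring

theorem hasSum_invFT_dotP_mul {r : ℝ} (hr : 0 < r) {H : ℕ → Pd d → ℂ}
    (hm : ∀ j, StronglyMeasurable (H j)) (hs : ∑' j, wnorm r (H j) < ⊤) (v z : Pd d) :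
    HasSum (fun j => invFT (fun w => Complex.I * dotP w v * H j w) z)
      (invFT (fun w => Complex.I * dotP w v * ∑' j, H j w) z) := by
  obtain ⟨C, hC⟩ := lintegral_enorm_dotP_mul_le hr v
  have hc : Continuous fun w : Pd d => Complex.I * (dotP w v : ℂ) := by
    have := continuous_dotP_left v
    fun_prop
  have h := hasSum_invFT (H := fun j w => Complex.I * dotP w v * H j w)
    (fun j => hc.stronglyMeasurable.mul (hm j)) (by
      refine (ENNReal.tsum_le_tsum fun j => hC (H j)).trans_lt ?_
      rw [ENNReal.tsum_mul_left]
      exact ENNReal.mul_lt_top ENNReal.ofReal_lt_top hs) z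
  simpa only [tsum_mul_left] using h

theorem memLp_two_dotP_mul {r C : ℝ} (hr : 0 < r) {h : Pd d → ℂ}
    (hm : AEStronglyMeasurable h volume) (hh : wnorm r h < ⊤)
    (hC : ∀ w, ‖h w‖ ≤ C * (1 + normP w)) (v : Pd d) :
    MemLp (fun w => Complex.I * dotP w v * h w) 2 := by
  have hc : Continuous fun w : Pd d => Complex.I * (dotP w v : ℂ) := by
    have := continuous_dotP_left v
    fun_prop
  have hm' := hc.aestronglyMeasurable.mul hm
  refine (memLp_two_iff_integrable_sq_norm hm').2 ?_
  refine ((integrable_one_add_pow_mul hr hm hh 3).const_mul (normP v ^ 2 * C)).mono'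
    (hm'.norm.pow 2) (.of_forall fun w => ?_)
  have h0 := normP_nonneg w
  have h1 : ‖Complex.I * (dotP w v : ℂ)‖ ≤ (1 + normP w) * normP v := by
    rw [norm_mul, Complex.norm_I, one_mul, Complex.norm_real]
    refine (abs_dotP_le w v).trans ?_
    have := normP_nonneg v
    gcongr
    linarith
  rw [Real.norm_of_nonneg (by positivity), Pi.mul_apply, norm_mul, mul_pow]
  calc ‖Complex.I * (dotP w v : ℂ)‖ ^ 2 * ‖h w‖ ^ 2
      ≤ ((1 + normP w) * normP v) ^ 2 * (C * (1 + normP w) * ‖h w‖) := by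
        rw [sq ‖h w‖]
        gcongr
        exact hC w
    _ = _ := by ring

theorem exists_enorm_poissonConv_le {r : ℝ} (hr : 0 < r) {g : Pd d → ℂ} {K : ℝ}
    (hK : ∀ w, ‖g w‖ ≤ K) : ∃ C : ℝ, ∀ (h : Pd d → ℂ) (w : Pd d),
      ‖poissonConv g h w‖ₑ ≤ ENNReal.ofReal (C * (1 + normP w)) * wnorm r h := by
  obtain ⟨C, hC0, hC⟩ := one_add_pow_le hr 2
  have hK0 : 0 ≤ K := (norm_nonneg _).trans (hK 0)
  refine ⟨K * C, fun h w => (enorm_poissonConv_le g h w).trans ?_⟩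
  have : (volume : Measure (Pd d)).Regular :=
    Measure.Regular.of_sigmaCompactSpace_of_isLocallyFiniteMeasure _
  have : (volume : Measure (Pd d)).IsNegInvariant :=
    Measure.IsAddHaarMeasure.isNegInvariant_of_regular _
  have h1 := lintegral_sub_left_eq_self (μ := (volume : Measure (Pd d)))
    (fun v => (ENNReal.ofReal (normP (w - v)) * ENNReal.ofReal K) *
      (ENNReal.ofReal (normP v) * ‖h v‖ₑ)) w
  simp only [sub_sub_cancel] at h1
  calc _ ≤ ∫⁻ u, (ENNReal.ofReal (normP u) * ENNReal.ofReal K) *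
      (ENNReal.ofReal (normP (w - u)) * ‖h (w - u)‖ₑ) := by
        refine lintegral_mono fun u => ?_
        refine mul_le_mul_left (mul_le_mul_right ?_ _) _
        rw [← ofReal_norm]
        exact ENNReal.ofReal_le_ofReal (hK u)
    _ ≤ _ := by
        rw [h1, wnorm, ← lintegral_const_mul' _ _ ENNReal.ofReal_ne_top]
        refine lintegral_mono fun v => ?_
        have hv := normP_nonneg v
        have hw := normP_nonneg w
        rw [← mul_assoc, mul_comm ‖h v‖ₑ, ← mul_assoc, ← ENNReal.ofReal_mul (normP_nonneg _),
          ← ENNReal.ofReal_mul (mul_nonneg (normP_nonneg _) hK0),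
          ← ENNReal.ofReal_mul (by positivity)]
        refine mul_le_mul_left (ENNReal.ofReal_le_ofReal ?_) _
        calc normP (w - v) * K * normP v ≤ (normP w + normP v) * K * normP v := by
              gcongr
              exact normP_sub_le w v
          _ ≤ K * (1 + normP w) * (1 + normP v) ^ 2 := by
              have : (normP w + normP v) * normP v ≤ (1 + normP w) * (1 + normP v) ^ 2 := by
                nlinarith [mul_nonneg hv hw, mul_nonneg (mul_nonneg hv hw) hv]
              nlinarith
          _ ≤ K * (1 + normP w) * (C * Real.exp (r * normP v)) := by
              gcongr
              exact hC _ hv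
          _ = _ := by ring

theorem poissonConv_const_mul (g h : Pd d → ℂ) (c : ℂ) :
    poissonConv g (fun w => c * h w) = fun w => c * poissonConv g h w := by
  ext w
  rw [poissonConv, poissonConv, mul_left_comm, ← integral_const_mul c]
  congr 2; ext u
  ring

theorem invFT_const_mul (h : Pd d → ℂ) (c : ℂ) (z : Pd d) :
    invFT (fun w => c * h w) z = c * invFT h z := by
  rw [invFT, invFT, mul_left_comm, ← integral_const_mul c]
  congr 2; ext w
  ring

theorem integrable_tsum_invFT_poissonConv {r K C : ℝ} (hr : 0 < r) {g : Pd d → ℂ}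
    (hg : StronglyMeasurable g) (hgr : wnorm r g < ⊤) (hK : ∀ w, ‖g w‖ ≤ K)
    {H : ℕ → Pd d → ℂ} (hm : ∀ j, StronglyMeasurable (H j)) (hs : ∑' j, wnorm r (H j) < ⊤)
    (hC : ∀ w, ‖∑' j, H j w‖ ≤ C * (1 + normP w)) :
    Integrable fun z => ∑' j, invFT (poissonConv g (H j)) z := by
  have hgm := hg.aestronglyMeasurable (μ := volume)
  have hgi := integrable_of_wnorm_lt_top hr.le hgm hgr
  have hgi' := integrable_normP_mul hr hgm hgr
  have hHr : ∀ j, wnorm r (H j) < ⊤ := fun j => (ENNReal.le_tsum j).trans_lt hs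
  have hSr := (wnorm_tsum_le (r := r) hm).trans_lt hs
  have hSm := aestronglyMeasurable_tsum hm
    ((ENNReal.tsum_le_tsum fun j => wnorm_zero_le hr.le (H j)).trans_lt hs)
  have hSi := integrable_of_wnorm_lt_top hr.le hSm hSr
  have hSi' := integrable_normP_mul hr hSm hSr
  have hK0 : 0 ≤ K := (norm_nonneg _).trans (hK 0)
  have hgL : ∀ v : Pd d, MemLp (invFT fun w => Complex.I * dotP w v * g w) 2 := fun v =>
    memLp_two_invFT (integrable_dotP_mul hgi hgi' v) (memLp_two_dotP_mul hr hgm hgr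
      (fun w => (hK w).trans (le_mul_of_one_le_right hK0 (by linarith [normP_nonneg w]))) v)
  have hSL : ∀ v : Pd d, MemLp (invFT fun w => Complex.I * dotP w v * ∑' j, H j w) 2 := fun v =>
    memLp_two_invFT (integrable_dotP_mul hSi hSi' v) (memLp_two_dotP_mul hr hSm hSr hC v)
  have key : (fun z => ∑' j, invFT (poissonConv g (H j)) z) = fun z => ∑ k,
      (invFT (fun w => Complex.I * dotP w (exi k) * g w) z *
          invFT (fun w => Complex.I * dotP w (ex k) * ∑' j, H j w) z -
        invFT (fun w => Complex.I * dotP w (ex k) * g w) z *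
          invFT (fun w => Complex.I * dotP w (exi k) * ∑' j, H j w) z) := by
    ext z
    refine HasSum.tsum_eq ?_
    have h1 : ∀ j, invFT (poissonConv g (H j)) z = _ := fun j =>
      (sum_invFT_mul_eq_invFT_poissonConv hgi hgi'
        (integrable_of_wnorm_lt_top hr.le (hm j).aestronglyMeasurable (hHr j))
        (integrable_normP_mul hr (hm j).aestronglyMeasurable (hHr j)) z).symm
    simp only [h1]
    exact hasSum_sum fun k _ => ((hasSum_invFT_dotP_mul hr hm hs _ z).mul_left _).sub
      ((hasSum_invFT_dotP_mul hr hm hs _ z).mul_left _)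
  rw [key]
  exact integrable_finsetSum _ fun k _ =>
    ((hgL _).integrable_mul (hSL _)).sub ((hgL _).integrable_mul (hSL _))

end Series

section Egorov

variable {d : ℕ}

theorem norm_fourierT_le (a : Pd d → ℂ) (w : Pd d) : ‖fourierT a w‖ ≤ ∫ z, ‖a z‖ := by
  refine (norm_integral_le_integral_norm _).trans (le_of_eq ?_)
  congr 1; ext z
  rw [norm_mul, show -(Complex.I * (dotP w z : ℂ)) = ((-dotP w z : ℝ) : ℂ) * Complex.I by
    push_cast; ring, Complex.norm_exp_ofReal_mul_I, one_mul]

theorem fourierT_of_not_integrable {a : Pd d → ℂ} (hm : AEStronglyMeasurable a volume)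
    (ha : ¬ Integrable a) : fourierT a = 0 := by
  ext w
  refine integral_undef fun h => ha (h.mono hm (.of_forall fun z => ?_))
  rw [norm_mul, show -(Complex.I * (dotP w z : ℂ)) = ((-dotP w z : ℝ) : ℂ) * Complex.I by
    push_cast; ring, Complex.norm_exp_ofReal_mul_I, one_mul]

theorem Anorm_invFT_le (r : ℝ) {h : Pd d → ℂ} (hh : Integrable h) :
    Anorm r (invFT h) ≤ wnorm r h := by
  by_cases hi : Integrable (invFT h)
  · rw [Anorm_eq_wnorm, wnorm_congr_ae (fourierT_invFT_ae_eq hh hi)]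
  · rw [Anorm_eq_wnorm, fourierT_of_not_integrable
      (continuous_invFT hh).aestronglyMeasurable hi]
    simp [wnorm]

theorem enorm_taylorCoeff (t : ℝ) (j : ℕ) :
    ‖((t ^ j / (j.factorial : ℝ) : ℝ) : ℂ)‖ₑ = ENNReal.ofReal (|t| ^ j / j.factorial) := by
  rw [← ofReal_norm, Complex.norm_real, norm_div, norm_pow, Real.norm_natCast, Real.norm_eq_abs]

theorem abs_pow_succ_div_factorial_le (t : ℝ) (j : ℕ) :
    |t| ^ (j + 1) / (j + 1).factorial ≤ |t| * (|t| ^ j / j.factorial) := by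
  have h1 : (j.factorial : ℝ) ≤ (j + 1).factorial := by
    exact_mod_cast Nat.factorial_le (Nat.le_succ j)
  calc |t| ^ (j + 1) / (j + 1).factorial ≤ |t| ^ (j + 1) / j.factorial := by gcongr
    _ = _ := by ring

theorem exists_norm_tsum_lieCoeff_le {r t K K' : ℝ} (hr : 0 < r) {g h : Pd d → ℂ}
    (hg : ∀ w, ‖g w‖ ≤ K) (hh : ∀ w, ‖h w‖ ≤ K')
    (hs : ∑' k : ℕ, ENNReal.ofReal (|t| ^ k / k.factorial) * wnorm r (lieCoeff g h k) < ⊤) :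
    ∃ C : ℝ, ∀ w, ‖∑' j : ℕ, ((t ^ (j + 1) / ((j + 1).factorial : ℝ) : ℝ) : ℂ) *
      lieCoeff g h j w‖ ≤ C * (1 + normP w) := by
  obtain ⟨C, hC⟩ := exists_enorm_poissonConv_le hr hg
  set S := ∑' k : ℕ, ENNReal.ofReal (|t| ^ k / k.factorial) * wnorm r (lieCoeff g h k)
  set B : ℝ≥0∞ := ENNReal.ofReal |t| * ENNReal.ofReal K' +
    ENNReal.ofReal |t| * ENNReal.ofReal |t| * ENNReal.ofReal C * S
  have hB : B ≠ ⊤ := by finiteness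
  refine ⟨B.toReal, fun w => ?_⟩
  have hw : 0 ≤ 1 + normP w := by linarith [normP_nonneg w]
  have key : ‖∑' j : ℕ, ((t ^ (j + 1) / ((j + 1).factorial : ℝ) : ℝ) : ℂ) *
      lieCoeff g h j w‖ₑ ≤ B * ENNReal.ofReal (1 + normP w) := by
    refine enorm_tsum_le_tsum_enorm.trans ?_
    rw [tsum_eq_zero_add' ENNReal.summable, add_mul]
    refine add_le_add ?_ ?_
    · simp only [lieCoeff, zero_add, pow_one, Nat.factorial_one, Nat.cast_one, div_one]
      rw [enorm_mul, ← ofReal_norm, ← ofReal_norm, Complex.norm_real, Real.norm_eq_abs]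
      refine (mul_le_mul_right (ENNReal.ofReal_le_ofReal (hh w)) _).trans
        (le_mul_of_one_le_right zero_le ?_)
      rw [ENNReal.one_le_ofReal]
      linarith [normP_nonneg w]
    · have hterm : ∀ j : ℕ, ‖((t ^ (j + 1 + 1) / ((j + 1 + 1).factorial : ℝ) : ℝ) : ℂ) *
          lieCoeff g h (j + 1) w‖ₑ ≤
          ENNReal.ofReal |t| * ENNReal.ofReal |t| * ENNReal.ofReal C *
            ENNReal.ofReal (1 + normP w) *
            (ENNReal.ofReal (|t| ^ j / j.factorial) * wnorm r (lieCoeff g h j)) := fun j => by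
        rw [enorm_mul, enorm_taylorCoeff]
        have h1 : |t| ^ (j + 1 + 1) / (j + 1 + 1).factorial ≤
            |t| * (|t| * (|t| ^ j / j.factorial)) :=
          (abs_pow_succ_div_factorial_le t (j + 1)).trans
            (mul_le_mul_of_nonneg_left (abs_pow_succ_div_factorial_le t j) (abs_nonneg t))
        refine (mul_le_mul' (ENNReal.ofReal_le_ofReal h1) (hC (lieCoeff g h j) w)).trans
          (le_of_eq ?_)
        rw [ENNReal.ofReal_mul (abs_nonneg t), ENNReal.ofReal_mul (abs_nonneg t),
          ENNReal.ofReal_mul' hw]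
        ring
      refine (ENNReal.tsum_le_tsum hterm).trans (le_of_eq ?_)
      rw [ENNReal.tsum_mul_left]
      ring
  have h2 := ENNReal.toReal_mono (ENNReal.mul_ne_top hB ENNReal.ofReal_ne_top) key
  rwa [toReal_enorm, ENNReal.toReal_mul, ENNReal.toReal_ofReal hw] at h2

theorem integrable_invFT_tsum_lieCoeff {r t K K' : ℝ} (hr : 0 < r) {g h : Pd d → ℂ}
    (hgm : StronglyMeasurable g) (hhm : StronglyMeasurable h) (hgr : wnorm r g < ⊤)
    (hg : ∀ w, ‖g w‖ ≤ K) (hh : ∀ w, ‖h w‖ ≤ K') (hi : Integrable (invFT h))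
    (hs : ∑' k : ℕ, ENNReal.ofReal (|t| ^ k / k.factorial) * wnorm r (lieCoeff g h k) < ⊤) :
    Integrable (invFT fun w => ∑' j : ℕ, ((t ^ j / (j.factorial : ℝ) : ℝ) : ℂ) *
      lieCoeff g h j w) := by
  have hm : ∀ (c : ℕ → ℂ) (k l : ℕ), StronglyMeasurable fun w => c k * lieCoeff g h l w :=
    fun c k l => stronglyMeasurable_const.mul (stronglyMeasurable_lieCoeff hgm hhm l)
  set c : ℕ → ℂ := fun j => ((t ^ j / (j.factorial : ℝ) : ℝ) : ℂ)
  have hs0 : ∑' k : ℕ, ∫⁻ w, ‖c k * lieCoeff g h k w‖ₑ < ⊤ := by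
    refine (ENNReal.tsum_le_tsum fun k => ?_).trans_lt hs
    refine (wnorm_zero_le hr.le _).trans (le_of_eq ?_)
    rw [wnorm_const_mul, enorm_taylorCoeff]
  have hs1 : ∑' k : ℕ, wnorm r (fun w => c (k + 1) * lieCoeff g h k w) < ⊤ := by
    have hle : ∀ k, wnorm r (fun w => c (k + 1) * lieCoeff g h k w) ≤ ENNReal.ofReal |t| *
        (ENNReal.ofReal (|t| ^ k / k.factorial) * wnorm r (lieCoeff g h k)) := fun k => by
      rw [wnorm_const_mul, enorm_taylorCoeff, ← mul_assoc, ← ENNReal.ofReal_mul (abs_nonneg t)]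
      exact mul_le_mul_left (ENNReal.ofReal_le_ofReal (abs_pow_succ_div_factorial_le t k)) _
    refine (ENNReal.tsum_le_tsum hle).trans_lt ?_
    rw [ENNReal.tsum_mul_left]
    exact ENNReal.mul_lt_top ENNReal.ofReal_lt_top hs
  obtain ⟨C, hC⟩ := exists_norm_tsum_lieCoeff_le hr hg hh hs
  have h1 := integrable_tsum_invFT_poissonConv hr hgm hgr hg (fun k => hm c (k + 1) k) hs1 hC
  refine (hi.add h1).congr (.of_forall fun z => ?_)
  have h2 := hasSum_invFT (fun k => hm c k k) hs0 z
  rw [← h2.tsum_eq, h2.summable.tsum_eq_zero_add]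
  simp [c, lieCoeff, poissonConv_const_mul]

end Egorov

/-- classical analytic Egorov / convergent Lie series for the flow.
If a ∈ A_s, G ∈ A_s is real-valued and nonzero, φ is the Hamiltonian flow of G, and
|t| ‖G‖_s < σ²/2, then Σ_j (t^j/j!) Ad_G^j(a) converges absolutely in ‖·‖_{s−σ},
its sum equals a ∘ φ_t^G, and a ∘ φ_t^G ∈ A_{s−σ}. -/
theorem classical_analytic_egorov {d : ℕ} (s σ : ℝ) (hs : 0 < s) (hσ : 0 < σ)
    (hσs : σ < s) (a : Pd d → ℂ) (ha_cont : Continuous a) (ha : MemAs s a)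
    (G : Pd d → ℝ) (hG_cont : Continuous G)
    (hG : MemAs s (fun z => (G z : ℂ))) (hG0 : Anorm s (fun z => (G z : ℂ)) ≠ 0)
    (φ : ℝ → Pd d → Pd d) (hφ0 : ∀ z, φ 0 z = z)
    (hφ : ∀ (t : ℝ) (z : Pd d), HasDerivAt (fun τ => φ τ z) (hamVF G (φ t z)) t)
    (t : ℝ)
    (ht : ENNReal.ofReal |t| * Anorm s (fun z => (G z : ℂ)) <
      ENNReal.ofReal (σ ^ 2 / 2)) :
    (∑' j : ℕ, Anorm (s - σ)
        (fun z => ((t ^ j / (j.factorial : ℝ) : ℝ) : ℂ) * adP G j a z)) < ⊤ ∧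
    (∀ z : Pd d,
      (∑' j : ℕ, ((t ^ j / (j.factorial : ℝ) : ℝ) : ℂ) * adP G j a z) = a (φ t z)) ∧
    MemAs (s - σ) (fun z => a (φ t z)) := by
  set g : Pd d → ℂ := fourierT fun z => (G z : ℂ)
  set h : Pd d → ℂ := fourierT a
  have hGc : Continuous fun z => (G z : ℂ) := Complex.continuous_ofReal.comp hG_cont
  have hr : 0 < s - σ := sub_pos.2 hσs
  have hgm : StronglyMeasurable g := stronglyMeasurable_fourierT hGc.stronglyMeasurable
  have hhm : StronglyMeasurable h := stronglyMeasurable_fourierT ha_cont.stronglyMeasurable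
  have hgs : wnorm s g < ⊤ := by simpa only [Anorm_eq_wnorm] using hG.2
  have hhs : wnorm s h < ⊤ := by simpa only [Anorm_eq_wnorm] using ha.2
  rw [Anorm_eq_wnorm] at ht
  have hgi := integrable_of_wnorm_lt_top hs.le hgm.aestronglyMeasurable hgs
  have hgi' := integrable_normP_mul hs hgm.aestronglyMeasurable hgs
  have hhi := integrable_of_wnorm_lt_top hs.le hhm.aestronglyMeasurable hhs
  have hGg : (fun z => (G z : ℂ)) = invFT g := (invFT_fourierT hGc hG.1 hgi).symm
  have hah : invFT h = a := invFT_fourierT ha_cont ha.1 hhi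
  have hkm := stronglyMeasurable_lieCoeff hgm hhm
  have hkr := wnorm_lieCoeff_lt_top hσ hσs.le hgm hhm hgs hhs
  have hki := fun k => integrable_of_wnorm_lt_top hr.le (hkm k).aestronglyMeasurable (hkr k)
  have hki' := fun k => integrable_normP_mul hr (hkm k).aestronglyMeasurable (hkr k)
  have hS := tsum_mul_wnorm_lieCoeff_lt_top hσ hσs.le hgm hhm hhs ht
  have had : ∀ k, adP G k a = invFT (lieCoeff g h k) := fun k => by
    rw [← hah]
    exact adP_eq_invFT_lieCoeff hGg hgi hgi' hki hki' k
  set H : ℕ → Pd d → ℂ := fun j w => ((t ^ j / (j.factorial : ℝ) : ℝ) : ℂ) * lieCoeff g h j w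
    with hH
  have hHm : ∀ j, StronglyMeasurable (H j) := fun j => stronglyMeasurable_const.mul (hkm j)
  have hHw : ∀ j : ℕ, wnorm (s - σ) (H j) =
      ENNReal.ofReal (|t| ^ j / j.factorial) * wnorm (s - σ) (lieCoeff g h j) := fun j => by
    rw [hH, wnorm_const_mul, enorm_taylorCoeff]
  have hHs : ∑' j, wnorm (s - σ) (H j) < ⊤ := by simpa only [hHw] using hS
  have hH0 : ∑' j, ∫⁻ w, ‖H j w‖ₑ < ⊤ :=
    (ENNReal.tsum_le_tsum fun j => wnorm_zero_le hr.le (H j)).trans_lt hHs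
  have hHinv : ∀ j z, ((t ^ j / (j.factorial : ℝ) : ℝ) : ℂ) * adP G j a z = invFT (H j) z :=
    fun j z => by rw [had, hH, invFT_const_mul]
  have hflow : ∀ z, HasSum (fun j : ℕ => ((t ^ j / (j.factorial : ℝ) : ℝ) : ℂ) * adP G j a z)
      (a (φ t z)) := by
    refine hasSum_taylor_comp_flow hφ0 hφ (fun j z => ?_) (fun j => rfl)
      (C := fun j => (wnorm (s - σ) (lieCoeff g h j)).toReal) (fun j z => ?_) ?_
    · rw [had]
      obtain ⟨L, hL, -⟩ := hasFDerivAt_invFT (hki j) (hki' j) z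
      exact hL.differentiableAt
    · rw [had, ← toReal_enorm]
      exact ENNReal.toReal_mono (hkr j).ne ((enorm_invFT_le _ z).trans (wnorm_zero_le hr.le _))
    · refine (ENNReal.summable_toReal hS.ne).congr fun j => ?_
      rw [ENNReal.toReal_mul, ENNReal.toReal_ofReal (by positivity)]
  have hcomp : (fun z => a (φ t z)) = invFT fun w => ∑' j, H j w := by
    ext z
    refine (hflow z).unique ?_
    simpa only [hHinv] using hasSum_invFT hHm hH0 z
  have hTi : Integrable fun w => ∑' j, H j w :=
    integrable_of_wnorm_lt_top hr.le (aestronglyMeasurable_tsum hHm hH0)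
      ((wnorm_tsum_le hHm).trans_lt hHs)
  refine ⟨?_, fun z => (hflow z).tsum_eq, ?_⟩
  · refine (ENNReal.tsum_le_tsum fun j => ?_).trans_lt hHs
    simp only [hHinv]
    exact Anorm_invFT_le _ ((hki j).const_mul _)
  · rw [hcomp]
    exact ⟨integrable_invFT_tsum_lieCoeff hr hgm hhm
      ((wnorm_mono (by linarith) g).trans_lt hgs) (norm_fourierT_le _) (norm_fourierT_le _)
      (hah ▸ ha.1) hS, (Anorm_invFT_le _ hTi).trans_lt ((wnorm_tsum_le hHm).trans_lt hHs)⟩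

end
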